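/- arXiv:2011.08540 — 3 statements merged into one kernel-verified Lean document; each statement's English description precedes it below -/
import Mathlib

section
/- If S is a symmetric proper numerical semigroup not equal to {0} ∪ {n ∈ ℕ : n ≥ 2}, then neither S ⊞_C S* nor S ⊞_D S* is a numerical semigroup (each is a numerical set that is not closed under addition). -/
/-- A numerical set: a subset of ℕ containing 0 with finite complement. -/
def IsNumericalSet (S : Set ℕ) : Prop := 0 ∈ S ∧ Sᶜ.Finite

/-- A numerical semigroup: a numerical set closed under addition. -/
def IsNumericalSemigroup (S : Set ℕ) : Prop :=
  IsNumericalSet S ∧ ∀ x ∈ S, ∀ y ∈ S, x + y ∈ S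

/-- The Frobenius number: the largest gap. -/
noncomputable def frob (S : Set ℕ) : ℕ := sSup Sᶜ

/-- The condNum: F(S) + 1. -/
noncomputable def condNum (S : Set ℕ) : ℕ := frob S + 1

/-- The genus: the number of gaps. -/
noncomputable def genus (S : Set ℕ) : ℕ := Sᶜ.ncard

/-- The dual of a numerical set: `S* = {x ∈ ℕ : F(S) − x ∉ S}`, difference taken in ℤ. -/
noncomputable def dual (S : Set ℕ) : Set ℕ :=
  {x : ℕ | ((frob S : ℤ) - (x : ℤ)) ∉ ((fun n : ℕ => (n : ℤ)) '' S)}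

/-- Discrete sum: `{s ∈ S : s < C(S)} ∪ {C(S) + 1 + t : t ∈ T}`. -/
noncomputable def dsum (S T : Set ℕ) : Set ℕ :=
  {s ∈ S | s < condNum S} ∪ (fun t => condNum S + 1 + t) '' T

/-- End-to-end sum: `{s ∈ S : s < C(S)} ∪ {C(S) + t : t ∈ T}`. -/
noncomputable def esum (S T : Set ℕ) : Set ℕ :=
  {s ∈ S | s < condNum S} ∪ (fun t => condNum S + t) '' T

/-- Conjoint sum: `{s ∈ S : s < C(S)} ∪ {C(S) − 1 + t : t ∈ T, t > 0}`. -/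
noncomputable def csum (S T : Set ℕ) : Set ℕ :=
  {s ∈ S | s < condNum S} ∪ {x | ∃ t ∈ T, 0 < t ∧ x = condNum S - 1 + t}

/-- Overlap sum: `{s ∈ S : s < C(S)} ∪ {C(S) − 2 + t : t ∈ T, t > 0}`. -/
noncomputable def osum (S T : Set ℕ) : Set ℕ :=
  {s ∈ S | s < condNum S} ∪ {x | ∃ t ∈ T, 0 < t ∧ x = condNum S - 2 + t}

/-- Symmetric numerical semigroup: F(S) odd and every integer not in S is F(S) minus an element of S. -/
def IsSymmetric (S : Set ℕ) : Prop :=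
  Odd (frob S) ∧ ∀ x : ℤ, x ∉ ((fun n : ℕ => (n : ℤ)) '' S) →
    (frob S : ℤ) - x ∈ ((fun n : ℕ => (n : ℤ)) '' S)

/-- Pseudo-symmetric numerical semigroup: F(S) even and every integer not in S is F(S)/2
or F(S) minus an element of S. -/
def IsPseudoSymmetric (S : Set ℕ) : Prop :=
  Even (frob S) ∧ ∀ x : ℤ, x ∉ ((fun n : ℕ => (n : ℤ)) '' S) →
    x = (frob S : ℤ) / 2 ∨ (frob S : ℤ) - x ∈ ((fun n : ℕ => (n : ℤ)) '' S)

theorem mem_of_frob_lt {S : Set ℕ} (hS : IsNumericalSet S) {n : ℕ} (hn : frob S < n) : n ∈ S := by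
  by_contra h
  exact absurd (le_csSup hS.2.bddAbove h) (not_le.mpr hn)

theorem one_notMem {S : Set ℕ} (hS : IsNumericalSemigroup S) (hSp : S ≠ Set.univ) : 1 ∉ S := by
  intro h
  refine hSp (Set.eq_univ_of_forall fun n => ?_)
  induction n with
  | zero => exact hS.1.1
  | succ n ih => exact hS.2 n ih 1 h

theorem IsSymmetric.sub_mem {S : Set ℕ} (hsym : IsSymmetric S) {n : ℕ} (hn : n ∉ S) :
    ∃ k ∈ S, k + n = frob S := by
  obtain ⟨k, hk, hkn⟩ := hsym.2 n (by simpa using hn)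
  exact ⟨k, hk, by simp only at hkn; omega⟩

theorem one_notMem_dual {S : Set ℕ} (hsym : IsSymmetric S) (h1 : 1 ∉ S) : 1 ∉ dual S := by
  obtain ⟨k, hk, hk1⟩ := hsym.sub_mem h1
  exact fun h => h ⟨k, hk, by simp only; omega⟩

/-- Apart from `{0, 2, 3, …}`, the conductor of a symmetric numerical semigroup is a sum of two
elements below the conductor: the smallest positive element `m` and `F(S) - (m - 1)`. -/
theorem IsSymmetric.exists_add_eq_condNum {S : Set ℕ} (hS : IsNumericalSemigroup S)
    (hSp : S ≠ Set.univ) (hsym : IsSymmetric S) (hne : S ≠ {0} ∪ {n : ℕ | 2 ≤ n}) :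
    ∃ x ∈ S, ∃ y ∈ S, x < condNum S ∧ y < condNum S ∧ x + y = condNum S := by
  classical
  have h1 := one_notMem hS hSp
  have hF1 : frob S ≠ 1 := by
    intro hF
    refine hne (Set.ext fun n => ?_)
    simp only [Set.mem_union, Set.mem_singleton_iff, Set.mem_ofPred_eq]
    constructor
    · intro hn
      have : n ≠ 1 := fun h => h1 (h ▸ hn)
      omega
    · rintro (rfl | hn)
      · exact hS.1.1
      · exact mem_of_frob_lt hS.1 (by omega)
  obtain ⟨k, hk, hk1⟩ := hsym.sub_mem h1
  have hex : ∃ n, 0 < n ∧ n ∈ S := ⟨k, by omega, hk⟩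
  obtain ⟨hm0, hmS⟩ := Nat.find_spec hex
  have hmk : Nat.find hex ≤ k := Nat.find_min' hex ⟨by omega, hk⟩
  have hm1 : Nat.find hex ≠ 1 := fun h => h1 (h ▸ hmS)
  have hgap : Nat.find hex - 1 ∉ S := fun h =>
    Nat.find_min hex (m := Nat.find hex - 1) (by omega) ⟨by omega, h⟩
  obtain ⟨y, hy, hym⟩ := hsym.sub_mem hgap
  refine ⟨_, hmS, y, hy, ?_, ?_, ?_⟩ <;> simp only [condNum] <;> omega

theorem condNum_notMem_csum {S T : Set ℕ} (hT : 1 ∉ T) : condNum S ∉ csum S T := by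
  rintro (⟨-, h⟩ | ⟨t, ht, -, h⟩)
  · exact lt_irrefl _ h
  · have : t = 1 := by simp only [condNum] at h; omega
    exact hT (this ▸ ht)

theorem condNum_notMem_dsum (S T : Set ℕ) : condNum S ∉ dsum S T := by
  rintro (⟨-, h⟩ | ⟨t, -, h⟩)
  · exact lt_irrefl _ h
  · simp only at h
    omega

theorem csum_dsum_dual_not_semigroup_of_symmetric (S : Set ℕ)
    (hS : IsNumericalSemigroup S) (hSp : S ≠ Set.univ)
    (hsym : IsSymmetric S)
    (hne : S ≠ {0} ∪ {n : ℕ | 2 ≤ n}) :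
    (¬ ∀ x ∈ csum S (dual S), ∀ y ∈ csum S (dual S), x + y ∈ csum S (dual S)) ∧
    (¬ ∀ x ∈ dsum S (dual S), ∀ y ∈ dsum S (dual S), x + y ∈ dsum S (dual S)) := by
  obtain ⟨x, hx, y, hy, hxC, hyC, hxy⟩ := hsym.exists_add_eq_condNum hS hSp hne
  refine ⟨fun h => ?_, fun h => ?_⟩
  · exact condNum_notMem_csum (one_notMem_dual hsym (one_notMem hS hSp))
      (hxy ▸ h x (Or.inl ⟨hx, hxC⟩) y (Or.inl ⟨hy, hyC⟩))
  · exact condNum_notMem_dsum S (dual S)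
      (hxy ▸ h x (Or.inl ⟨hx, hxC⟩) y (Or.inl ⟨hy, hyC⟩))
end

section
/- Let S be a proper numerical semigroup. If 2·C(S) − a − b − 1 ≠ c for all small elements a, b, c of S, then S ⊞_E S* is a symmetric numerical semigroup. If 2·F(S) − a − b − 1 ≠ c for all small elements a, b, c of S, then S ⊞_O S* is a symmetric numerical semigroup. -/
/-- The set that agrees with `S` below `M` and is completed above `M` by the reflection
`x ↦ 2 * M - 1 - x`, which exchanges elements and gaps. -/
def reflectAt (S : Set ℕ) (M : ℕ) : Set ℕ :=
  {x | (x < M ∧ x ∈ S) ∨ (M ≤ x ∧ ∀ s ∈ S, x + s + 1 ≠ 2 * M)}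

theorem isGreatest_compl_reflectAt {S : Set ℕ} {M : ℕ} (h0 : 0 ∈ S) (hM : 0 < M) :
    IsGreatest (reflectAt S M)ᶜ (2 * M - 1) := by
  constructor
  · rintro (⟨h, -⟩ | ⟨-, h⟩)
    · omega
    · exact h 0 h0 (by omega)
  · intro x hx
    by_contra hlt
    exact hx (Or.inr ⟨by omega, fun s _ => by omega⟩)

theorem frob_reflectAt {S : Set ℕ} {M : ℕ} (h0 : 0 ∈ S) (hM : 0 < M) :
    frob (reflectAt S M) = 2 * M - 1 :=
  (isGreatest_compl_reflectAt h0 hM).csSup_eq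

theorem isSymmetric_reflectAt {S : Set ℕ} {M : ℕ} (h0 : 0 ∈ S) (hM : 0 < M) :
    IsSymmetric (reflectAt S M) := by
  rw [IsSymmetric, frob_reflectAt h0 hM]
  refine ⟨⟨M - 1, by omega⟩, fun x hx => ?_⟩
  have hx' : ∀ n ∈ reflectAt S M, (n : ℤ) ≠ x := fun n hn h => hx ⟨n, hn, h⟩
  rcases lt_or_ge x M with hlt | hge
  · refine ⟨(2 * M - 1 - x).toNat, Or.inr ⟨by omega, fun s hs h => ?_⟩, ?_⟩
    · exact hx' s (Or.inl ⟨by omega, hs⟩) (by omega)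
    · simp only
      omega
  · lift x to ℕ using by omega
    have hgap : ¬ ∀ s ∈ S, x + s + 1 ≠ 2 * M :=
      fun h => hx' x (Or.inr ⟨by omega, h⟩) rfl
    push Not at hgap
    obtain ⟨s, hs, h⟩ := hgap
    refine ⟨s, Or.inl ⟨by omega, hs⟩, ?_⟩
    simp only
    omega

theorem isNumericalSemigroup_reflectAt {S : Set ℕ} {M : ℕ} (h0 : 0 ∈ S)
    (hadd : ∀ x ∈ S, ∀ y ∈ S, x + y ∈ S) (hM : 0 < M)
    (hsmall : ∀ a ∈ S, ∀ b ∈ S, ∀ c ∈ S, a < M → b < M → c < M → a + b + c + 1 ≠ 2 * M) :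
    IsNumericalSemigroup (reflectAt S M) := by
  have hmixed : ∀ x ∈ S, ∀ y, M ≤ y → (∀ s ∈ S, y + s + 1 ≠ 2 * M) →
      x + y ∈ reflectAt S M := fun x hx y hy h =>
    Or.inr ⟨by omega, fun s hs hxy => h (x + s) (hadd x hx s hs) (by omega)⟩
  refine ⟨⟨Or.inl ⟨hM, h0⟩, ?_⟩, ?_⟩
  · exact (isGreatest_compl_reflectAt h0 hM).bddAbove.finite
  · rintro x (⟨hx, hxS⟩ | ⟨hx, hxS⟩) y (⟨hy, hyS⟩ | ⟨hy, hyS⟩)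
    · rcases lt_or_ge (x + y) M with h | h
      · exact Or.inl ⟨h, hadd x hxS y hyS⟩
      · exact Or.inr ⟨h, fun s hs hsum =>
          hsmall x hxS y hyS s hs hx hy (by omega) hsum⟩
    · exact hmixed x hxS y hy hyS
    · exact add_comm y x ▸ hmixed y hyS x hx hxS
    · exact Or.inr ⟨by omega, fun s _ => by omega⟩

theorem mem_dual_iff {S : Set ℕ} {x : ℕ} : x ∈ dual S ↔ ∀ s ∈ S, x + s ≠ frob S := by
  simp only [dual, Set.mem_ofPred_eq, Set.mem_image, not_exists, not_and]
  exact forall₂_congr fun s _ => by omega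

theorem frob_notMem {S : Set ℕ} (hS : IsNumericalSet S) (hSp : S ≠ Set.univ) :
    frob S ∉ S :=
  Nat.sSup_mem (Set.nonempty_compl.mpr hSp) hS.2.bddAbove

theorem esum_dual (S : Set ℕ) : esum S (dual S) = reflectAt S (condNum S) := by
  ext x
  simp only [esum, reflectAt, condNum, Set.mem_union, Set.mem_ofPred_eq, Set.mem_image,
    mem_dual_iff]
  refine or_congr and_comm ⟨?_, ?_⟩
  · rintro ⟨t, ht, rfl⟩
    exact ⟨by omega, fun s hs h => ht s hs (by omega)⟩
  · rintro ⟨hx, h⟩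
    exact ⟨x - (frob S + 1), fun s hs h' => h s hs (by omega), by omega⟩

theorem osum_dual {S : Set ℕ} (hF : frob S ∉ S) (hpos : 0 < frob S) :
    osum S (dual S) = reflectAt S (frob S) := by
  ext x
  simp only [osum, reflectAt, condNum, Set.mem_union, Set.mem_ofPred_eq, mem_dual_iff]
  refine or_congr ⟨?_, ?_⟩ ⟨?_, ?_⟩
  · rintro ⟨hxS, hx⟩
    have hne : x ≠ frob S := fun h => hF (h ▸ hxS)
    exact ⟨by omega, hxS⟩
  · rintro ⟨hx, hxS⟩
    exact ⟨hxS, by omega⟩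
  · rintro ⟨t, ht, ht0, rfl⟩
    exact ⟨by omega, fun s hs h => ht s hs (by omega)⟩
  · rintro ⟨hx, h⟩
    exact ⟨x + 1 - frob S, fun s hs h' => h s hs (by omega), by omega, by omega⟩

theorem esum_osum_dual_symmetric (S : Set ℕ)
    (hS : IsNumericalSemigroup S) (hSp : S ≠ Set.univ) :
    ((∀ a ∈ S, ∀ b ∈ S, ∀ c ∈ S, a < condNum S → b < condNum S → c < condNum S →
        2 * (condNum S : ℤ) - (a : ℤ) - (b : ℤ) - 1 ≠ (c : ℤ)) →
      IsNumericalSemigroup (esum S (dual S)) ∧ IsSymmetric (esum S (dual S))) ∧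
    ((∀ a ∈ S, ∀ b ∈ S, ∀ c ∈ S, a < condNum S → b < condNum S → c < condNum S →
        2 * (frob S : ℤ) - (a : ℤ) - (b : ℤ) - 1 ≠ (c : ℤ)) →
      IsNumericalSemigroup (osum S (dual S)) ∧ IsSymmetric (osum S (dual S))) := by
  obtain ⟨⟨h0, hfin⟩, hadd⟩ := hS
  have hF : frob S ∉ S := frob_notMem ⟨h0, hfin⟩ hSp
  have hpos : 0 < frob S := Nat.pos_of_ne_zero fun h => hF (h ▸ h0)
  have hC : 0 < condNum S := Nat.succ_pos _
  constructor
  · intro h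
    rw [esum_dual]
    refine ⟨isNumericalSemigroup_reflectAt h0 hadd hC ?_, isSymmetric_reflectAt h0 hC⟩
    intro a ha b hb c hc hac hbc hcc
    have := h a ha b hb c hc hac hbc hcc
    omega
  · intro h
    rw [osum_dual hF hpos]
    refine ⟨isNumericalSemigroup_reflectAt h0 hadd hpos ?_, isSymmetric_reflectAt h0 hpos⟩
    intro a ha b hb c hc haF hbF hcF
    have := h a ha b hb c hc (Nat.lt_succ_of_lt haF) (Nat.lt_succ_of_lt hbF)
      (Nat.lt_succ_of_lt hcF)
    omega
end

section
/- Let S be a proper numerical semigroup such that C(S) is a minimal generator of S (i.e., C(S) ≠ a + b for all nonzero a, b ∈ S). If 2·C(S) − a − b ≠ c for all small elements a, b, c of S, then S ⊞_D S* is a pseudo-symmetric numerical semigroup. If 2·F(S) − a − b ≠ c for all small elements a, b, c of S, then S ⊞_C S* is a pseudo-symmetric numerical semigroup. -/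
/-- The reflection of the part of `S` below `K` through `K`: keep the elements of `S` below `K`, and
above `K` take those `x` for which `2 * K - x` is not an element of `S`. -/
def reflect (S : Set ℕ) (K : ℕ) : Set ℕ :=
  {x | (x ∈ S ∧ x < K) ∨ (K < x ∧ ∀ s ∈ S, s + x ≠ 2 * K)}

theorem mem_reflect_of_two_mul_lt {S : Set ℕ} {K x : ℕ} (hx : 2 * K < x) : x ∈ reflect S K :=
  Or.inr ⟨by lia, fun s _ => by lia⟩

theorem compl_reflect_subset (S : Set ℕ) (K : ℕ) : (reflect S K)ᶜ ⊆ Set.Iic (2 * K) := by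
  intro x hx
  by_contra h
  exact hx (mem_reflect_of_two_mul_lt (not_le.mp h))

theorem frob_reflect {S : Set ℕ} {K : ℕ} (h0 : 0 ∈ S) : frob (reflect S K) = 2 * K := by
  refine IsGreatest.csSup_eq ⟨?_, fun x hx => compl_reflect_subset S K hx⟩
  rintro (⟨-, h⟩ | ⟨-, h⟩)
  · lia
  · exact h 0 h0 (by lia)

theorem isNumericalSemigroup_reflect {S : Set ℕ} {K : ℕ} (h0 : 0 ∈ S)
    (hadd : ∀ x ∈ S, ∀ y ∈ S, x + y ∈ S) (hK : 0 < K)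
    (hpair : ∀ a ∈ S, ∀ b ∈ S, a < K → b < K → a + b ≠ K)
    (htriple : ∀ a ∈ S, ∀ b ∈ S, ∀ c ∈ S, a < K → b < K → c < K → a + b + c ≠ 2 * K) :
    IsNumericalSemigroup (reflect S K) := by
  refine ⟨⟨Or.inl ⟨h0, hK⟩, (Set.finite_Iic _).subset (compl_reflect_subset S K)⟩, ?_⟩
  rintro a (⟨ha, haK⟩ | ⟨haK, ha⟩) b (⟨hb, hbK⟩ | ⟨hbK, hb⟩)
  · rcases lt_trichotomy (a + b) K with h | h | h
    · exact Or.inl ⟨hadd a ha b hb, h⟩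
    · exact absurd h (hpair a ha b hb haK hbK)
    · refine Or.inr ⟨h, fun s hs hsum => ?_⟩
      exact htriple a ha b hb s hs haK hbK (by lia) (by lia)
  · refine Or.inr ⟨by lia, fun s hs hsum => hb (s + a) (hadd s hs a ha) (by lia)⟩
  · refine Or.inr ⟨by lia, fun s hs hsum => ha (s + b) (hadd s hs b hb) (by lia)⟩
  · exact mem_reflect_of_two_mul_lt (by lia)

theorem isPseudoSymmetric_reflect {S : Set ℕ} {K : ℕ} (h0 : 0 ∈ S) :
    IsPseudoSymmetric (reflect S K) := by
  rw [IsPseudoSymmetric, frob_reflect h0]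
  refine ⟨even_two_mul K, fun x hx => ?_⟩
  rcases lt_trichotomy x K with h | h | h
  · refine Or.inr ⟨(2 * K - x).toNat, Or.inr ⟨by lia, fun s hs hsum => ?_⟩, by
      push_cast; lia⟩
    exact hx ⟨s, Or.inl ⟨hs, by lia⟩, by push_cast; lia⟩
  · left
    push_cast
    lia
  · right
    by_contra hcon
    refine hx ⟨x.toNat, Or.inr ⟨by lia, fun s hs hsum => hcon ?_⟩, by push_cast; lia⟩
    exact ⟨s, Or.inl ⟨hs, by lia⟩, by push_cast; lia⟩

theorem mem_dual {S : Set ℕ} {x : ℕ} : x ∈ dual S ↔ ∀ s ∈ S, s + x ≠ frob S := by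
  simp only [dual, Set.mem_ofPred_eq, Set.mem_image, not_exists, not_and]
  exact forall₂_congr fun s _ => by lia

theorem dsum_dual (S : Set ℕ) : dsum S (dual S) = reflect S (condNum S) := by
  ext x
  refine or_congr Iff.rfl ⟨?_, fun ⟨hx, h⟩ => ?_⟩
  · rintro ⟨t, ht, rfl⟩
    rw [mem_dual] at ht
    refine ⟨by lia, fun s hs hsum => ht s hs ?_⟩
    simp only [condNum] at hsum
    lia
  · refine ⟨x - (condNum S + 1), mem_dual.mpr fun s hs hsum => h s hs ?_, by lia⟩
    simp only [condNum] at *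
    lia

theorem csum_dual {S : Set ℕ} (hF : frob S ∉ S) : csum S (dual S) = reflect S (frob S) := by
  ext x
  refine or_congr ?_ ⟨?_, fun ⟨hx, h⟩ => ?_⟩
  · refine and_congr_right fun hx => ?_
    have : x ≠ frob S := fun h => hF (h ▸ hx)
    simp only [condNum]
    lia
  · rintro ⟨t, ht, htpos, rfl⟩
    rw [mem_dual] at ht
    simp only [condNum]
    exact ⟨by lia, fun s hs hsum => ht s hs (by lia)⟩
  · refine ⟨x - frob S, mem_dual.mpr fun s hs hsum => h s hs (by lia), by lia, ?_⟩
    simp only [condNum]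
    lia

theorem dsum_csum_dual_pseudosymmetric (S : Set ℕ)
    (hS : IsNumericalSemigroup S) (hSp : S ≠ Set.univ)
    (hmin : ∀ a ∈ S, ∀ b ∈ S, a ≠ 0 → b ≠ 0 → a + b ≠ condNum S) :
    ((∀ a ∈ S, ∀ b ∈ S, ∀ c ∈ S, a < condNum S → b < condNum S → c < condNum S →
        2 * (condNum S : ℤ) - (a : ℤ) - (b : ℤ) ≠ (c : ℤ)) →
      IsNumericalSemigroup (dsum S (dual S)) ∧ IsPseudoSymmetric (dsum S (dual S))) ∧
    ((∀ a ∈ S, ∀ b ∈ S, ∀ c ∈ S, a < condNum S → b < condNum S → c < condNum S →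
        2 * (frob S : ℤ) - (a : ℤ) - (b : ℤ) ≠ (c : ℤ)) →
      IsNumericalSemigroup (csum S (dual S)) ∧ IsPseudoSymmetric (csum S (dual S))) := by
  obtain ⟨hset, hadd⟩ := hS
  have h0 := hset.1
  have hF := frob_notMem hset hSp
  have hFpos : 0 < frob S := Nat.pos_of_ne_zero fun h => hF (h ▸ h0)
  rw [dsum_dual, csum_dual hF]
  refine ⟨fun htriple => ⟨?_, isPseudoSymmetric_reflect h0⟩,
    fun htriple => ⟨?_, isPseudoSymmetric_reflect h0⟩⟩
  · refine isNumericalSemigroup_reflect h0 hadd (Nat.succ_pos _) ?_ ?_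
    · intro a ha b hb haK hbK
      by_cases h : a = 0 ∨ b = 0
      · lia
      · exact hmin a ha b hb (by tauto) (by tauto)
    · intro a ha b hb c hc haK hbK hcK hsum
      exact htriple a ha b hb c hc haK hbK hcK (by lia)
  · refine isNumericalSemigroup_reflect h0 hadd hFpos ?_ ?_
    · exact fun a ha b hb _ _ h => hF (h ▸ hadd a ha b hb)
    · intro a ha b hb c hc haK hbK hcK hsum
      exact htriple a ha b hb c hc (Nat.lt_succ_of_lt haK) (Nat.lt_succ_of_lt hbK)
        (Nat.lt_succ_of_lt hcK) (by lia)
end
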